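/- arXiv:2210.01111 — 3 statements merged into one kernel-verified Lean document; each statement's English description precedes it below -/
import Mathlib

section
/- Let X have law N(x, σ²I) and Y have law N(x+δ, σ²I) on ℝ^d, and let F : ℝ^d → {0,1} be a random or deterministic measurable function. If W = {w ∈ ℝ^d : δᵀw ≥ β} for some β ∈ ℝ and Pr(F(X) = 1) ≤ Pr(X ∈ W), then Pr(F(Y) = 1) ≤ Pr(Y ∈ W). -/
open MeasureTheory ProbabilityTheory

/-- Isotropic Gaussian measure `N(m, σ²I)` on `ℝ^d`, as a product of 1-D Gaussians. -/
noncomputable def gaussPi (d : ℕ) (m : Fin d → ℝ) (σ : ℝ) : Measure (Fin d → ℝ) :=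
  Measure.pi fun i => gaussianReal (m i) ⟨σ ^ 2, sq_nonneg σ⟩

/-- Standard Gaussian CDF `Φ`. -/
noncomputable def Phi (x : ℝ) : ℝ := (gaussianReal 0 1 (Set.Iic x)).toReal

/-- Inverse of the standard Gaussian CDF, `Φ⁻¹` (genuine inverse on `(0,1)` since `Φ` is a
strictly increasing continuous bijection from `ℝ` onto `(0,1)`). -/
noncomputable def PhiInv : ℝ → ℝ := Function.invFun Phi

/-- Euclidean dot product `aᵀb` on `ℝ^d`. -/
noncomputable def dotp (d : ℕ) (a b : Fin d → ℝ) : ℝ := ∑ i, a i * b i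

/-- Euclidean norm `‖a‖₂` on `ℝ^d`. -/
noncomputable def enorm2 (d : ℕ) (a : Fin d → ℝ) : ℝ := Real.sqrt (∑ i, a i ^ 2)

/-- Density of a product of measures given by densities. -/
lemma pi_withDensity_eq {ι : Type*} [Fintype ι] {α : ι → Type*} [∀ i, MeasurableSpace (α i)]
    (μ : ∀ i, Measure (α i)) [∀ i, IsProbabilityMeasure (μ i)]
    (f : ∀ i, α i → ENNReal) (hf : ∀ i, Measurable (f i))
    [∀ i, SigmaFinite ((μ i).withDensity (f i))] :
    Measure.pi (fun i => (μ i).withDensity (f i)) =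
      (Measure.pi μ).withDensity (fun w => ∏ i, f i (w i)) := by
  refine Measure.pi_eq fun s hs => ?_
  have hind : iIndepFun (fun i (w : ∀ i, α i) => (s i).indicator (f i) (w i)) (Measure.pi μ) :=
    iIndepFun_pi (X := fun i => (s i).indicator (f i))
      fun i => ((hf i).indicator (hs i)).aemeasurable
  have hprod : (Set.univ.pi s).indicator (fun w : ∀ i, α i => ∏ i, f i (w i)) =
      fun w => ∏ i, (s i).indicator (f i) (w i) := by
    classical
    ext w
    by_cases hw : w ∈ Set.univ.pi s
    · rw [Set.indicator_of_mem hw]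
      exact Finset.prod_congr rfl fun i _ => (Set.indicator_of_mem (hw i trivial) _).symm
    · rw [Set.indicator_of_notMem hw]
      simp only [Set.mem_pi, Set.mem_univ, forall_const, not_forall] at hw
      obtain ⟨i, hi⟩ := hw
      exact (Finset.prod_eq_zero (Finset.mem_univ i) (Set.indicator_of_notMem hi _)).symm
  have hpi : MeasurableSet (Set.univ.pi s) := MeasurableSet.univ_pi hs
  rw [withDensity_apply _ hpi, ← lintegral_indicator hpi, hprod,
    lintegral_prod_eq_prod_lintegral_of_indepFun Finset.univ _ hind
      fun i => ((hf i).indicator (hs i)).comp (measurable_pi_apply i)]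
  refine Finset.prod_congr rfl fun i _ => ?_
  rw [withDensity_apply _ (hs i), ← lintegral_indicator (hs i)]
  exact (measurePreserving_eval μ i).lintegral_comp ((hf i).indicator (hs i))

/-- A translated Gaussian is the original Gaussian weighted by an exponential. -/
lemma gaussianReal_add_eq_withDensity (m a : ℝ) {v : NNReal} (hv : v ≠ 0) :
    gaussianReal (m + a) v = (gaussianReal m v).withDensity
      (fun t => ENNReal.ofReal (Real.exp ((a * (t - m) - a ^ 2 / 2) / v))) := by
  have hv' : (v : ℝ) ≠ 0 := by exact_mod_cast hv
  rw [gaussianReal_of_var_ne_zero _ hv, gaussianReal_of_var_ne_zero _ hv,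
    ← withDensity_mul _ (measurable_gaussianPDF m v) (by fun_prop)]
  congr 1
  ext t
  rw [Pi.mul_apply, gaussianPDF, gaussianPDF,
    ← ENNReal.ofReal_mul (gaussianPDFReal_nonneg m v t), gaussianPDFReal, gaussianPDFReal,
    mul_assoc _ (Real.exp _), ← Real.exp_add]
  congr 3
  field_simp
  ring

/-- Neyman–Pearson: superlevel sets of the likelihood ratio are most powerful tests. -/
lemma neyman_pearson {Ω : Type*} [MeasurableSpace Ω] (P : Measure Ω) [IsProbabilityMeasure P]
    {L : Ω → ℝ} (hLm : Measurable L) (hL : ∀ w, 0 ≤ L w)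
    [IsFiniteMeasure (P.withDensity fun w => ENNReal.ofReal (L w))]
    {k : ℝ} (hk : 0 ≤ k) {F : Ω → ℝ} (hFm : Measurable F) (hF : ∀ w, F w ∈ Set.Icc (0 : ℝ) 1)
    (h : ∫ w, F w ∂P ≤ P.real {w | k ≤ L w}) :
    ∫ w, F w ∂(P.withDensity fun w => ENNReal.ofReal (L w)) ≤
      (P.withDensity fun w => ENNReal.ofReal (L w)).real {w | k ≤ L w} := by
  set W := {w | k ≤ L w} with hW
  have hWm : MeasurableSet W := measurableSet_le measurable_const hLm
  have hdens : ∀ g : Ω → ℝ, ∫ w, g w ∂(P.withDensity fun w => ENNReal.ofReal (L w)) =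
      ∫ w, L w * g w ∂P := fun g => by
    rw [integral_withDensity_eq_integral_toReal_smul hLm.ennreal_ofReal (by simp)]
    simp [ENNReal.toReal_ofReal (hL _)]
  have hLi : Integrable L P := by
    refine ⟨hLm.aestronglyMeasurable, ?_⟩
    rw [hasFiniteIntegral_iff_ofReal (.of_forall hL), ← setLIntegral_univ,
      ← withDensity_apply _ .univ]
    exact measure_lt_top _ _
  have hbdd : ∀ {g : Ω → ℝ}, (∀ w, g w ∈ Set.Icc (0 : ℝ) 1) → ∀ w, ‖g w‖ ≤ 1 :=
    fun hg w => by rw [Real.norm_of_nonneg (hg w).1]; exact (hg w).2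
  have hFi : Integrable F P :=
    .of_bound hFm.aestronglyMeasurable 1 (.of_forall (hbdd hF))
  have h1m : Measurable (W.indicator (1 : Ω → ℝ)) := measurable_one.indicator hWm
  have h1 : ∀ w, W.indicator (1 : Ω → ℝ) w ∈ Set.Icc (0 : ℝ) 1 := fun w => by
    by_cases hw : w ∈ W <;> simp [hw]
  have h1i : Integrable (W.indicator (1 : Ω → ℝ)) P :=
    .of_bound h1m.aestronglyMeasurable 1 (.of_forall (hbdd h1))
  have hLF : Integrable (fun w => L w * F w) P :=
    hLi.mul_bdd (c := 1) hFm.aestronglyMeasurable (.of_forall (hbdd hF))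
  have hL1 : Integrable (fun w => L w * W.indicator (1 : Ω → ℝ) w) P :=
    hLi.mul_bdd (c := 1) h1m.aestronglyMeasurable (.of_forall (hbdd h1))
  rw [← integral_indicator_one hWm] at h ⊢
  rw [hdens, hdens]
  have key : ∫ w, (L w * F w + k * W.indicator (1 : Ω → ℝ) w) ∂P ≤
      ∫ w, (L w * W.indicator (1 : Ω → ℝ) w + k * F w) ∂P := by
    refine integral_mono (hLF.add (h1i.const_mul k)) (hL1.add (hFi.const_mul k)) fun w => ?_
    obtain ⟨h0, h1⟩ := hF w
    by_cases hw : w ∈ W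
    · have : k ≤ L w := hw
      simp only [Set.indicator_of_mem hw, Pi.one_apply]
      nlinarith
    · have : L w < k := not_le.1 hw
      simp only [Set.indicator_of_notMem hw]
      nlinarith
  rw [integral_add hLF (h1i.const_mul k), integral_add hL1 (hFi.const_mul k),
    integral_const_mul, integral_const_mul] at key
  linarith [mul_le_mul_of_nonneg_left h hk]

lemma gaussPi_eq_pi {d : ℕ} (m : Fin d → ℝ) (σ : ℝ) :
    gaussPi d m σ = Measure.pi fun i => gaussianReal (m i) (σ ^ 2).toNNReal :=
  congrArg (fun v : NNReal => Measure.pi fun i => gaussianReal (m i) v)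
    (Real.toNNReal_of_nonneg (sq_nonneg σ)).symm

instance isProbabilityMeasure_gaussPi {d : ℕ} (m : Fin d → ℝ) (σ : ℝ) :
    IsProbabilityMeasure (gaussPi d m σ) := by
  rw [gaussPi_eq_pi]
  infer_instance

/-- Likelihood ratio of two isotropic Gaussians with the same variance. -/
lemma gaussPi_add_eq_withDensity {d : ℕ} (x δ : Fin d → ℝ) {σ : ℝ} (hσ : σ ≠ 0) :
    gaussPi d (x + δ) σ = (gaussPi d x σ).withDensity (fun w => ENNReal.ofReal
      (Real.exp ((dotp d δ w - (dotp d δ x + dotp d δ δ / 2)) / σ ^ 2))) := by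
  rw [gaussPi_eq_pi, gaussPi_eq_pi]
  have hv : ((σ ^ 2).toNNReal : ℝ) = σ ^ 2 := Real.coe_toNNReal _ (sq_nonneg σ)
  generalize (σ ^ 2).toNNReal = v at hv
  have hv0 : v ≠ 0 := fun h0 => pow_ne_zero 2 hσ (by rw [← hv, h0, NNReal.coe_zero])
  rw [← hv]
  have hone := fun i => gaussianReal_add_eq_withDensity (x i) (δ i) hv0
  have : ∀ i, SigmaFinite ((gaussianReal (x i) v).withDensity
      (fun t => ENNReal.ofReal (Real.exp ((δ i * (t - x i) - δ i ^ 2 / 2) / v)))) := fun i => by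
    rw [← hone i]; infer_instance
  simp only [Pi.add_apply, hone]
  rw [pi_withDensity_eq _ _ fun i => by fun_prop]
  congr 1
  ext w
  rw [← ENNReal.ofReal_prod_of_nonneg fun i _ => (Real.exp_pos _).le, ← Real.exp_sum]
  congr 2
  simp only [dotp]
  rw [← Finset.sum_div, Finset.sum_div _ (fun i => δ i * δ i), ← Finset.sum_add_distrib,
    ← Finset.sum_sub_distrib]
  congr 1
  exact Finset.sum_congr rfl fun i _ => by ring

/-- Neyman–Pearson for Gaussians with different means, part (2):
if `W = {w | δᵀw ≥ β}` and `Pr(F(X)=1) ≤ Pr(X ∈ W)`, then `Pr(F(Y)=1) ≤ Pr(Y ∈ W)`,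
where `X ~ N(x, σ²I)`, `Y ~ N(x+δ, σ²I)` and the random function `F` is represented by
the measurable map `F1 = F(1|·) : ℝ^d → [0,1]`. -/
theorem stmt1 {d : ℕ} (x δ : Fin d → ℝ) (σ : ℝ) (hσ : 0 < σ)
    (F1 : (Fin d → ℝ) → ℝ) (hF1m : Measurable F1)
    (hF1 : ∀ w, F1 w ∈ Set.Icc (0 : ℝ) 1)
    (β : ℝ) (W : Set (Fin d → ℝ)) (hW : W = {w | β ≤ dotp d δ w})
    (h : ∫ w, F1 w ∂(gaussPi d x σ) ≤ ((gaussPi d x σ) W).toReal) :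
    ∫ w, F1 w ∂(gaussPi d (x + δ) σ) ≤ ((gaussPi d (x + δ) σ) W).toReal := by
  have hQ : IsProbabilityMeasure (gaussPi d (x + δ) σ) := inferInstance
  rw [gaussPi_add_eq_withDensity x δ hσ.ne'] at hQ ⊢
  have hWL : W = {w | Real.exp ((β - (dotp d δ x + dotp d δ δ / 2)) / σ ^ 2) ≤
      Real.exp ((dotp d δ w - (dotp d δ x + dotp d δ δ / 2)) / σ ^ 2)} := by
    ext w
    rw [hW, Set.mem_ofPred_eq, Set.mem_ofPred_eq, Real.exp_le_exp,
      div_le_div_iff_of_pos_right (by positivity), sub_le_sub_iff_right]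
  have hm : Measurable fun w : Fin d → ℝ =>
      Real.exp ((dotp d δ w - (dotp d δ x + dotp d δ δ / 2)) / σ ^ 2) := by
    unfold dotp; fun_prop
  rw [hWL] at h ⊢
  exact neyman_pearson _ hm (fun w => (Real.exp_pos _).le) (Real.exp_pos _).le hF1m hF1 h
end

section
/- Assume δ ≠ 0 and let q ∈ (0,1). Define the half-space B = {w ∈ ℝ^d : δᵀ(w − x) ≥ σ‖δ‖₂ Φ⁻¹(1 − q)}. Then Pr(X ∈ B) = q and Pr(Y ∈ B) = Φ(Φ⁻¹(q) + ‖δ‖₂/σ). -/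
open MeasureTheory ProbabilityTheory

open scoped NNReal

lemma Phi_eq_cdf : Phi = cdf (gaussianReal 0 1) := by
  ext t
  rw [cdf_eq_real]
  rfl

lemma strictMono_Phi : StrictMono Phi := by
  have : (gaussianReal 0 1).IsOpenPosMeasure :=
    (gaussianReal_absolutelyContinuous' 0 one_ne_zero).isOpenPosMeasure
  intro a b hab
  have h0 : 0 < gaussianReal 0 1 (Set.Ioc a b) :=
    (isOpen_Ioo.measure_pos _ (Set.nonempty_Ioo.2 hab)).trans_le
      (measure_mono Set.Ioo_subset_Ioc_self)
  have hdisj : Disjoint (Set.Iic a) (Set.Ioc a b) := Set.Iic_disjoint_Ioc le_rfl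
  have hsum : Phi b = Phi a + (gaussianReal 0 1 (Set.Ioc a b)).toReal := by
    rw [Phi, Phi, ← Set.Iic_union_Ioc_eq_Iic hab.le, measure_union hdisj measurableSet_Ioc,
      ENNReal.toReal_add (measure_ne_top _ _) (measure_ne_top _ _)]
  rw [hsum]
  exact lt_add_of_pos_right _ (ENNReal.toReal_pos h0.ne' (measure_ne_top _ _))

lemma continuous_Phi : Continuous Phi := by
  have : NullSingletonClass (gaussianReal 0 1) := nullSingletonClass_gaussianReal one_ne_zero
  rw [Phi_eq_cdf, continuous_iff_continuousAt]
  intro t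
  have hmono := monotone_cdf (gaussianReal 0 1)
  rw [hmono.continuousAt_iff_leftLim_eq_rightLim, StieltjesFunction.rightLim_eq]
  have h := (cdf (gaussianReal 0 1)).measure_singleton t
  rw [measure_cdf, measure_singleton, eq_comm, ENNReal.ofReal_eq_zero, sub_nonpos] at h
  exact le_antisymm (hmono.leftLim_le le_rfl) h

lemma Phi_PhiInv {p : ℝ} (hp : p ∈ Set.Ioo (0 : ℝ) 1) : Phi (PhiInv p) = p := by
  refine Function.invFun_eq (mem_range_of_exists_le_of_exists_ge continuous_Phi ?_ ?_)
  · rw [Phi_eq_cdf]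
    exact ((tendsto_cdf_atBot _).eventually_le_const hp.1).exists
  · rw [Phi_eq_cdf]
    exact ((tendsto_cdf_atTop _).eventually_const_le hp.2).exists

lemma gaussianReal_Ici_toReal (m t : ℝ) {s : ℝ} (hs : 0 < s) {v : ℝ≥0} (hv : (v : ℝ) = s ^ 2) :
    (gaussianReal m v (Set.Ici (s * t))).toReal = Phi (m / s - t) := by
  have hlaw : HasLaw (fun z ↦ -s * z + m) (gaussianReal m v) (gaussianReal 0 1) := by
    have hv' : v = .mk ((-s) ^ 2) (sq_nonneg _) * 1 := by
      ext
      simp [hv]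
    have h := gaussianReal_add_const
      (gaussianReal_const_mul (HasLaw.id (μ := gaussianReal 0 1)) (-s)) m
    rwa [← hv', mul_zero, zero_add] at h
  rw [← hlaw.map_eq, Measure.map_apply (by fun_prop) measurableSet_Ici, Phi]
  congr 2
  ext z
  simp only [Set.mem_preimage, Set.mem_Ici, Set.mem_Iic]
  rw [le_sub_iff_add_le, le_div_iff₀ hs]
  constructor <;> intro h <;> linarith

lemma Phi_neg (t : ℝ) : Phi (-t) = 1 - Phi t := by
  have : NullSingletonClass (gaussianReal 0 1) := nullSingletonClass_gaussianReal one_ne_zero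
  have h := gaussianReal_Ici_toReal 0 t one_pos (v := 1) (by simp)
  rw [one_mul, zero_div, zero_sub, ← measure_congr Ioi_ae_eq_Ici, ← Set.compl_Iic] at h
  rw [← h]
  exact probReal_compl_eq_one_sub measurableSet_Iic

lemma PhiInv_one_sub {q : ℝ} (hq : q ∈ Set.Ioo (0 : ℝ) 1) : PhiInv (1 - q) = -PhiInv q := by
  apply strictMono_Phi.injective
  rw [Phi_neg, Phi_PhiInv hq, Phi_PhiInv ⟨by linarith [hq.2], by linarith [hq.1]⟩]

lemma hasLaw_pi_gaussianReal_sum {ι : Type*} [Fintype ι] (a m : ι → ℝ) (v : ℝ≥0) :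
    HasLaw (fun w : ι → ℝ ↦ ∑ i, a i * w i)
      (gaussianReal (∑ i, a i * m i) (v * ∑ i, a i ^ 2).toNNReal)
      (Measure.pi fun i ↦ gaussianReal (m i) v) := by
  refine ⟨(show Measurable _ by fun_prop).aemeasurable, ?_⟩
  have heval (i : ι) : HasLaw (fun w : ι → ℝ ↦ w i) (gaussianReal (m i) v)
      (Measure.pi fun i ↦ gaussianReal (m i) v) :=
    (measurePreserving_eval (fun i ↦ gaussianReal (m i) v) i).hasLaw
  have hterm (i : ι) : HasGaussianLaw (fun w : ι → ℝ ↦ a i * w i)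
      (Measure.pi fun i ↦ gaussianReal (m i) v) :=
    (gaussianReal_const_mul (heval i) (a i)).hasGaussianLaw
  have hindep : iIndepFun (fun i (w : ι → ℝ) ↦ a i * w i)
      (Measure.pi fun i ↦ gaussianReal (m i) v) :=
    iIndepFun_pi (X := fun i z ↦ a i * z) (fun i ↦ by fun_prop)
  rw [(hindep.hasGaussianLaw_fun_sum hterm).map_eq_gaussianReal]
  congr 2
  · rw [integral_finsetSum _ fun i _ ↦ (hterm i).integrable]
    simp_rw [integral_const_mul, (heval _).integral_eq, integral_id_gaussianReal]
  · have hvar := IndepFun.variance_sum (s := Finset.univ) (fun i _ ↦ (hterm i).memLp_two)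
      fun i _ j _ hij ↦ hindep.indepFun hij
    rw [Finset.sum_fn] at hvar
    rw [hvar]
    simp_rw [variance_const_mul, (heval _).variance_eq, variance_id_gaussianReal,
      Finset.mul_sum, mul_comm]

lemma enorm2_sq (d : ℕ) (a : Fin d → ℝ) : enorm2 d a ^ 2 = ∑ i, a i ^ 2 :=
  Real.sq_sqrt (Finset.sum_nonneg fun _ _ ↦ sq_nonneg _)

lemma enorm2_pos {d : ℕ} {a : Fin d → ℝ} (ha : a ≠ 0) : 0 < enorm2 d a := by
  obtain ⟨i, hi⟩ := Function.ne_iff.1 ha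
  exact Real.sqrt_pos.2 (Finset.sum_pos' (fun _ _ ↦ sq_nonneg _)
    ⟨i, Finset.mem_univ i, sq_pos_of_ne_zero hi⟩)

lemma gaussPi_halfSpace_toReal {d : ℕ} (x m : Fin d → ℝ) {δ : Fin d → ℝ} (hδ : δ ≠ 0) {σ : ℝ}
    (hσ : 0 < σ) (t : ℝ) :
    (gaussPi d m σ {w | σ * enorm2 d δ * t ≤ dotp d δ (w - x)}).toReal =
      Phi (dotp d δ (m - x) / (σ * enorm2 d δ) - t) := by
  have hlaw : HasLaw (fun w ↦ dotp d δ (w - x))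
      (gaussianReal (dotp d δ (m - x)) (σ ^ 2 * ∑ i, δ i ^ 2).toNNReal) (gaussPi d m σ) := by
    convert gaussianReal_sub_const
      (hasLaw_pi_gaussianReal_sum δ m ⟨σ ^ 2, sq_nonneg σ⟩) (dotp d δ x) using 2
    · simp [dotp, mul_sub]
    · simp [dotp, mul_sub]
    · rfl
    · rfl
  rw [hlaw.measure_eq measurableSet_Ici]
  refine gaussianReal_Ici_toReal _ t (mul_pos hσ (enorm2_pos hδ)) ?_
  rw [mul_pow, enorm2_sq, Real.coe_toNNReal _ (by positivity)]

/-- For `q ∈ (0,1)` and the half-space `B = {w | δᵀ(w−x) ≥ σ‖δ‖₂ Φ⁻¹(1−q)}`: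
`Pr(X ∈ B) = q` and `Pr(Y ∈ B) = Φ(Φ⁻¹(q) + ‖δ‖₂/σ)`, where `X ~ N(x, σ²I)` and
`Y ~ N(x+δ, σ²I)`. -/
theorem stmt3 {d : ℕ} (x δ : Fin d → ℝ) (hδ : δ ≠ 0) (σ : ℝ) (hσ : 0 < σ)
    (q : ℝ) (hq : q ∈ Set.Ioo (0 : ℝ) 1)
    (B : Set (Fin d → ℝ))
    (hB : B = {w | σ * enorm2 d δ * PhiInv (1 - q) ≤ dotp d δ (w - x)}) :
    ((gaussPi d x σ) B).toReal = q ∧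
    ((gaussPi d (x + δ) σ) B).toReal = Phi (PhiInv q + enorm2 d δ / σ) := by
  subst hB
  have hδ' := enorm2_pos hδ
  constructor
  · rw [gaussPi_halfSpace_toReal x x hδ hσ, PhiInv_one_sub hq, sub_neg_eq_add]
    simp [dotp, Phi_PhiInv hq]
  · rw [gaussPi_halfSpace_toReal x (x + δ) hδ hσ, PhiInv_one_sub hq, sub_neg_eq_add, add_comm]
    have hdot : dotp d δ (x + δ - x) = enorm2 d δ ^ 2 := by
      simp [enorm2_sq, dotp, ← sq]
    rw [hdot]
    congr 2
    field_simp
end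

section
/- Let X and Y be random vectors in ℝ^d whose laws have densities p_X and p_Y with respect to Lebesgue measure, let F₁, …, F_t : ℝ^d → {0,1} be random or deterministic measurable functions, and let k' be a positive integer such that ∑_{i=1}^t F_i(1|w) ≤ k' for all w ∈ ℝ^d. If W = {w ∈ ℝ^d : p_Y(w) ≥ μ · p_X(w)} for some μ > 0 and (1/k') ∑_{i=1}^t Pr(F_i(X) = 1) ≤ Pr(X ∈ W), then (1/k') ∑_{i=1}^t Pr(F_i(Y) = 1) ≤ Pr(Y ∈ W). -/
open MeasureTheory ProbabilityTheory

/-- Integrating a bounded measurable function against a finite measure with density `p`. -/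
theorem integral_withDensity_ofReal {α : Type*} [MeasurableSpace α] {ν : Measure α}
    {p : α → ℝ} (hp : Measurable p) (hp0 : ∀ w, 0 ≤ p w)
    [IsFiniteMeasure (ν.withDensity fun w => ENNReal.ofReal (p w))]
    {g : α → ℝ} (hg : Measurable g) {C : ℝ} (hC : ∀ w, |g w| ≤ C) :
    Integrable (fun w => p w * g w) ν ∧
      ∫ w, g w ∂(ν.withDensity fun w => ENNReal.ofReal (p w)) = ∫ w, p w * g w ∂ν := by
  have hint : Integrable g (ν.withDensity fun w => ENNReal.ofReal (p w)) :=
    .of_bound hg.aestronglyMeasurable C (.of_forall hC)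
  have hlt : ∀ᵐ w ∂ν, ENNReal.ofReal (p w) < ⊤ := .of_forall fun _ => ENNReal.ofReal_lt_top
  constructor
  · rw [integrable_withDensity_iff_integrable_smul' hp.ennreal_ofReal hlt] at hint
    simpa [ENNReal.toReal_ofReal, hp0] using hint
  · rw [integral_withDensity_eq_integral_toReal_smul hp.ennreal_ofReal hlt]
    simp [ENNReal.toReal_ofReal, hp0]

/-- Neyman–Pearson lemma for a single randomized test `G`. -/
theorem integral_le_measureReal_of_likelihood_ratio {α : Type*} [MeasurableSpace α]
    {ν : Measure α} {p q : α → ℝ} (hp : Measurable p) (hq : Measurable q)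
    (hp0 : ∀ w, 0 ≤ p w) (hq0 : ∀ w, 0 ≤ q w)
    [IsFiniteMeasure (ν.withDensity fun w => ENNReal.ofReal (p w))]
    [IsFiniteMeasure (ν.withDensity fun w => ENNReal.ofReal (q w))]
    {G : α → ℝ} (hG : Measurable G) (hG01 : ∀ w, G w ∈ Set.Icc (0 : ℝ) 1)
    {c : ℝ} (hc : 0 ≤ c)
    (h : ∫ w, G w ∂(ν.withDensity fun w => ENNReal.ofReal (p w)) ≤
      (ν.withDensity fun w => ENNReal.ofReal (p w)).real {w | c * p w ≤ q w}) :
    ∫ w, G w ∂(ν.withDensity fun w => ENNReal.ofReal (q w)) ≤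
      (ν.withDensity fun w => ENNReal.ofReal (q w)).real {w | c * p w ≤ q w} := by
  set W : Set α := {w | c * p w ≤ q w} with hW
  have hWm : MeasurableSet W := measurableSet_le (hp.const_mul c) hq
  have hIm : Measurable (W.indicator (1 : α → ℝ)) := measurable_one.indicator hWm
  have hGb : ∀ w, |G w| ≤ 1 := fun w => abs_le.2 ⟨by linarith [(hG01 w).1], (hG01 w).2⟩
  have hIb : ∀ w, |W.indicator (1 : α → ℝ) w| ≤ 1 := fun w => by
    by_cases hw : w ∈ W <;> simp [hw]
  obtain ⟨ipG, epG⟩ := integral_withDensity_ofReal (ν := ν) hp hp0 hG hGb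
  obtain ⟨iqG, eqG⟩ := integral_withDensity_ofReal (ν := ν) hq hq0 hG hGb
  obtain ⟨ipI, epI⟩ := integral_withDensity_ofReal (ν := ν) hp hp0 hIm hIb
  obtain ⟨iqI, eqI⟩ := integral_withDensity_ofReal (ν := ν) hq hq0 hIm hIb
  rw [← integral_indicator_one hWm, epG, epI] at h
  rw [← integral_indicator_one hWm, eqG, eqI]
  have key : ∫ w, c * (p w * W.indicator 1 w - p w * G w) ∂ν ≤
      ∫ w, (q w * W.indicator 1 w - q w * G w) ∂ν := by
    refine integral_mono ((ipI.sub ipG).const_mul c) (iqI.sub iqG) fun w => ?_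
    obtain ⟨h0, h1⟩ := hG01 w
    by_cases hw : w ∈ W
    · have hw' : c * p w ≤ q w := hw
      simp only [Set.indicator_of_mem hw, Pi.one_apply]
      nlinarith
    · have hw' : q w < c * p w := not_le.1 hw
      simp only [Set.indicator_of_notMem hw]
      nlinarith
  rw [integral_const_mul, integral_sub ipI ipG, integral_sub iqI iqG] at key
  nlinarith [mul_nonneg hc (sub_nonneg.2 h)]


/-- Neyman–Pearson variant for multiple functions, part (2): `X, Y` random vectors with
densities `pX, pY` w.r.t. Lebesgue measure, measurable random functions
`F₁,…,F_t : ℝ^d → {0,1}` (represented by `F i = F_i(1|·) : ℝ^d → [0,1]`) with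
`∑ᵢ F_i(1|w) ≤ k'` everywhere. If `W = {w | pY(w) ≥ μ·pX(w)}` for some `μ > 0` and
`(1/k') ∑ᵢ Pr(F_i(X)=1) ≤ Pr(X ∈ W)`, then `(1/k') ∑ᵢ Pr(F_i(Y)=1) ≤ Pr(Y ∈ W)`. -/
theorem stmt5 {d : ℕ} (μX μY : Measure (Fin d → ℝ))
    [IsProbabilityMeasure μX] [IsProbabilityMeasure μY]
    (pX pY : (Fin d → ℝ) → ℝ) (hpXm : Measurable pX) (hpYm : Measurable pY)
    (hpX0 : ∀ w, 0 ≤ pX w) (hpY0 : ∀ w, 0 ≤ pY w)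
    (hX : μX = volume.withDensity fun w => ENNReal.ofReal (pX w))
    (hY : μY = volume.withDensity fun w => ENNReal.ofReal (pY w))
    (t : ℕ) (F : Fin t → (Fin d → ℝ) → ℝ)
    (hFm : ∀ i, Measurable (F i)) (hF01 : ∀ i w, F i w ∈ Set.Icc (0 : ℝ) 1)
    (k' : ℕ) (hk' : 1 ≤ k') (hsum : ∀ w, ∑ i, F i w ≤ (k' : ℝ))
    (μ : ℝ) (hμ : 0 < μ)
    (W : Set (Fin d → ℝ)) (hW : W = {w | μ * pX w ≤ pY w})
    (h : (1 / (k' : ℝ)) * ∑ i, ∫ w, F i w ∂μX ≤ (μX W).toReal) :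
    (1 / (k' : ℝ)) * ∑ i, ∫ w, F i w ∂μY ≤ (μY W).toReal := by
  subst hX hY hW
  have hk : (0 : ℝ) < k' := by exact_mod_cast hk'
  have hFint : ∀ (ρ : Measure (Fin d → ℝ)) [IsFiniteMeasure ρ],
      (1 / (k' : ℝ)) * ∑ i, ∫ w, F i w ∂ρ = ∫ w, (1 / (k' : ℝ)) * ∑ i, F i w ∂ρ := by
    intro ρ _
    rw [integral_const_mul, integral_finsetSum]
    exact fun i _ => .of_bound (hFm i).aestronglyMeasurable 1 (.of_forall fun w =>
      abs_le.2 ⟨by linarith [(hF01 i w).1], (hF01 i w).2⟩)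
  rw [hFint] at h ⊢
  refine integral_le_measureReal_of_likelihood_ratio hpXm hpYm hpX0 hpY0 ?_ (fun w => ⟨?_, ?_⟩)
    hμ.le h
  · fun_prop
  · exact mul_nonneg (by positivity) (Finset.sum_nonneg fun i _ => (hF01 i w).1)
  · rw [one_div, inv_mul_le_one₀ hk]
    exact hsum w
end
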